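/- Let λ ∈ [0,1), F a λ-regular CDF with density on [a,b) ⊆ [0,∞), s ≥ 2 an integer, and m = E[v^{(1,s)}] finite. Then 1 − F(m)^{s−1} ≥ ((s−1)/s)·c(λ); that is, the maximum of s − 1 i.i.d. draws from F exceeds the expected maximum of s i.i.d. draws with probability at least ((s−1)/s)·c(λ). -/

import Mathlib

open MeasureTheory Filter

/-- The `j`-th largest value (1-indexed) among the `t` coordinates of `v`. -/
noncomputable def orderStat (t j : ℕ) (v : Fin t → ℝ) : ℝ :=
  ((List.ofFn v).insertionSort (· ≤ ·)).getD (t - j) 0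

/-- The expectation of the `j`-th largest of `t` i.i.d. draws from `μ`. -/
noncomputable def orderStatExp (μ : Measure ℝ) (j t : ℕ) : ℝ :=
  ∫ v, orderStat t j v ∂(Measure.pi fun _ : Fin t => μ)

/-- `F` is a CDF with density `f` on `[a, b)` (where possibly `b = ∞`):
differentiable with positive derivative `f` there, `F a = 0`, `F` nondecreasing,
and `F x → 1` as `x → b`. -/
def IsCDF (F f : ℝ → ℝ) (a : ℝ) (b : EReal) : Prop :=
  (a : EReal) < b ∧ Monotone F ∧ F a = 0 ∧
  (∀ x : ℝ, a ≤ x → (x : EReal) < b → HasDerivAt F (f x) x ∧ 0 < f x) ∧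
  Tendsto F (Filter.comap (fun x : ℝ => (x : EReal)) (nhdsWithin b (Set.Iio b))) (nhds 1)

/-- `μ` is the probability measure on `[a, b)` induced by the CDF `F`. -/
def InducedBy (μ : Measure ℝ) (F : ℝ → ℝ) (a : ℝ) (b : EReal) : Prop :=
  IsProbabilityMeasure μ ∧
  ∀ x : ℝ, a ≤ x → (x : EReal) < b → μ (Set.Iic x) = ENNReal.ofReal (F x)

/-- `λ`-regularity of the CDF `F` with density `f` on `[a, b)`. -/
def LambdaRegular (l : ℝ) (F f : ℝ → ℝ) (a : ℝ) (b : EReal) : Prop :=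
  MonotoneOn (fun v => l * v - (1 - F v) / f v) {x : ℝ | a ≤ x ∧ (x : EReal) < b}

/-- `c(λ) = (1 - λ)^(1/λ)` for `λ ∈ (0,1]`, with `c(0) = 1/e`. -/
noncomputable def cReg (l : ℝ) : ℝ := if l = 0 then (Real.exp 1)⁻¹ else (1 - l) ^ (1 / l)

/-- Symmetrised geometric sums: `u ^ (-n) * ∑ i ≤ n, u ^ (2 i)` decreases on `(0, 1]`. -/
lemma pow_mul_geom_sum_sq_le {u w : ℝ} (hu : 0 ≤ u) (huw : u ≤ w) (hw : w ≤ 1) :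
    ∀ n : ℕ, u ^ n * ∑ i ∈ Finset.range (n + 1), (w ^ 2) ^ i ≤
      w ^ n * ∑ i ∈ Finset.range (n + 1), (u ^ 2) ^ i
  | 0 => by simp
  | 1 => by
    have h : u * w ≤ 1 := mul_le_one₀ (huw.trans hw) (hu.trans huw) hw
    simp only [Finset.sum_range_succ, Finset.sum_range_zero]
    nlinarith [mul_nonneg (sub_nonneg.2 huw) (sub_nonneg.2 h)]
  | n + 2 => by
    have ih := pow_mul_geom_sum_sq_le hu huw hw n
    have hw0 : 0 ≤ w := hu.trans huw
    have key : ∀ x : ℝ, ∑ i ∈ Finset.range (n + 2 + 1), (x ^ 2) ^ i =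
        1 + x ^ 2 * ∑ i ∈ Finset.range (n + 1), (x ^ 2) ^ i + (x ^ (n + 2)) ^ 2 := by
      intro x
      rw [Finset.sum_range_succ, Finset.sum_range_succ', Finset.mul_sum]
      simp only [pow_succ]
      ring_nf
    rw [key, key]
    have hp : u ^ (n + 2) ≤ w ^ (n + 2) := pow_le_pow_left₀ hu huw _
    have hq : u ^ (n + 2) * w ^ (n + 2) ≤ 1 :=
      mul_le_one₀ (pow_le_one₀ hu (huw.trans hw)) (pow_nonneg hw0 _) (pow_le_one₀ hw0 hw)
    have h1 := mul_nonneg (sub_nonneg.2 hp) (sub_nonneg.2 hq)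
    have h2 := mul_le_mul_of_nonneg_left ih (mul_nonneg (sq_nonneg u) (sq_nonneg w))
    have e1 : u ^ (n + 2) = u ^ 2 * u ^ n := by ring
    have e2 : w ^ (n + 2) = w ^ 2 * w ^ n := by ring
    set X := ∑ i ∈ Finset.range (n + 1), (w ^ 2) ^ i
    set Y := ∑ i ∈ Finset.range (n + 1), (u ^ 2) ^ i
    have h3 : u ^ (n + 2) * (w ^ 2 * X) ≤ w ^ (n + 2) * (u ^ 2 * Y) := by
      rw [e1, e2]; linarith
    nlinarith

lemma geom_sum_pos_of_nonneg {x : ℝ} (hx : 0 ≤ x) (n : ℕ) :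
    0 < ∑ i ∈ Finset.range (n + 1), x ^ i := by
  rw [Finset.sum_range_succ']
  have := Finset.sum_nonneg fun i (_ : i ∈ Finset.range n) => pow_nonneg hx (i + 1)
  simp only [pow_zero]
  linarith

lemma pow_mul_geom_sum_rpow_monotoneOn {l : ℝ} (hl : l ≤ 1) (n : ℕ) :
    MonotoneOn (fun x : ℝ => x ^ n * (∑ i ∈ Finset.range (n + 1), x ^ i) ^ (-l - 1))
      (Set.Icc 0 1) := by
  intro x hx y hy hxy
  have hAx := geom_sum_pos_of_nonneg hx.1 n
  have hAy := geom_sum_pos_of_nonneg hy.1 n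
  have hA : ∑ i ∈ Finset.range (n + 1), x ^ i ≤ ∑ i ∈ Finset.range (n + 1), y ^ i :=
    Finset.sum_le_sum fun i _ => pow_le_pow_left₀ hx.1 hxy i
  have key := pow_mul_geom_sum_sq_le (Real.sqrt_nonneg x) (Real.sqrt_le_sqrt hxy)
    (Real.sqrt_le_one.2 hy.2) n
  rw [Real.sq_sqrt hx.1, Real.sq_sqrt hy.1] at key
  have split : ∀ z : ℝ, 0 < z → z ^ (-l - 1) = z ^ (1 - l) * (z ^ 2)⁻¹ := by
    intro z hz
    rw [show -l - 1 = (1 - l) + (-(2 : ℕ) : ℝ) by push_cast; ring, Real.rpow_add hz,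
      Real.rpow_neg hz.le, Real.rpow_natCast]
  simp only
  rw [split _ hAx, split _ hAy]
  set X := ∑ i ∈ Finset.range (n + 1), x ^ i
  set Y := ∑ i ∈ Finset.range (n + 1), y ^ i
  have hsq : x ^ n * (X ^ 2)⁻¹ ≤ y ^ n * (Y ^ 2)⁻¹ := by
    rw [← div_eq_mul_inv, ← div_eq_mul_inv, div_le_div_iff₀ (by positivity) (by positivity)]
    have h := pow_le_pow_left₀ (by positivity) key 2
    rw [mul_pow, mul_pow, ← pow_mul, ← pow_mul, mul_comm n 2, pow_mul, pow_mul,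
      Real.sq_sqrt hx.1, Real.sq_sqrt hy.1] at h
    exact h
  have hr : X ^ (1 - l) ≤ Y ^ (1 - l) := Real.rpow_le_rpow hAx.le hA (by linarith)
  have h0 : 0 ≤ x ^ n * (X ^ 2)⁻¹ := mul_nonneg (pow_nonneg hx.1 _) (by positivity)
  calc x ^ n * (X ^ (1 - l) * (X ^ 2)⁻¹) = x ^ n * (X ^ 2)⁻¹ * X ^ (1 - l) := by ring
    _ ≤ y ^ n * (Y ^ 2)⁻¹ * Y ^ (1 - l) := mul_le_mul hsq hr (by positivity) (h0.trans hsq)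
    _ = _ := by ring

lemma succ_mul_pow_le {x : ℝ} (hx0 : 0 ≤ x) (hx1 : x ≤ 1) (n : ℕ) :
    ((n : ℝ) + 1) * x ^ n ≤ 1 + n * x ^ (n + 1) := by
  induction n with
  | zero => simp
  | succ n ih =>
    have h1 := mul_le_mul_of_nonneg_left ih hx0
    have h2 := mul_nonneg (sub_nonneg.2 hx1)
      (sub_nonneg.2 (pow_le_one₀ hx0 hx1 : x ^ (n + 1) ≤ 1))
    push_cast
    ring_nf at h1 h2 ⊢
    linarith

section Regular

variable {l a : ℝ} {b : EReal} {F f : ℝ → ℝ}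

lemma IsCDF.strictMonoOn (hF : IsCDF F f a b) :
    StrictMonoOn F {x : ℝ | a ≤ x ∧ (x : EReal) < b} := by
  intro x hx y hy hxy
  have hmem : ∀ z ∈ Set.Icc x y, HasDerivAt F (f z) z ∧ 0 < f z := fun z hz =>
    hF.2.2.2.1 z (hx.1.trans hz.1) (lt_of_le_of_lt (EReal.coe_le_coe_iff.2 hz.2) hy.2)
  refine strictMonoOn_of_deriv_pos (convex_Icc x y)
    (fun z hz => (hmem z hz).1.continuousAt.continuousWithinAt) (fun z hz => ?_)
    (Set.left_mem_Icc.2 hxy.le) (Set.right_mem_Icc.2 hxy.le) hxy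
  rw [(hmem z (interior_subset hz)).1.deriv]
  exact (hmem z (interior_subset hz)).2

lemma comap_nhdsLT_neBot (hab : (a : EReal) < b) :
    (Filter.comap (fun x : ℝ => (x : EReal)) (nhdsWithin b (Set.Iio b))).NeBot := by
  rw [Filter.comap_neBot_iff]
  intro t ht
  obtain ⟨c, hc, hct⟩ := (mem_nhdsLT_iff_exists_Ioo_subset' hab).1 ht
  obtain ⟨y, hy1, hy2⟩ := EReal.lt_iff_exists_real_btwn.1 hc
  exact ⟨y, hct ⟨hy1, hy2⟩⟩

lemma eventually_comap_nhdsLT {c : ℝ} (hc : (c : EReal) < b) :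
    ∀ᶠ x in Filter.comap (fun x : ℝ => (x : EReal)) (nhdsWithin b (Set.Iio b)),
      c ≤ x ∧ (x : EReal) < b :=
  (Filter.Eventually.comap (p := fun x => x ∈ Set.Ioo (c : EReal) b) (Ioo_mem_nhdsLT hc) _).mono
    fun _ hx => ⟨(EReal.coe_lt_coe_iff.1 hx.1).le, hx.2⟩

lemma IsCDF.lt_one (hF : IsCDF F f a b) {x : ℝ} (hx : a ≤ x) (hxb : (x : EReal) < b) :
    F x < 1 := by
  obtain ⟨y, hy1, hy2⟩ := EReal.lt_iff_exists_real_btwn.1 hxb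
  have hxy : x < y := EReal.coe_lt_coe_iff.1 hy1
  refine (hF.strictMonoOn ⟨hx, hxb⟩ ⟨hx.trans hxy.le, hy2⟩ hxy).trans_le ?_
  have := comap_nhdsLT_neBot hF.1
  exact ge_of_tendsto hF.2.2.2.2 ((eventually_comap_nhdsLT hy2).mono fun z hz => hF.2.1 hz.1)

/-- The derivative of `((1 - F) ^ (-l) - 1) / l` is nondecreasing for `l`-regular `F`. -/
lemma LambdaRegular.monotoneOn_density_mul_rpow (hl : 0 < l) (hF : IsCDF F f a b)
    (hreg : LambdaRegular l F f a b) :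
    MonotoneOn (fun v => f v * (1 - F v) ^ (-l - 1)) {x : ℝ | a ≤ x ∧ (x : EReal) < b} := by
  intro x hx y hy hxy
  have hmem : ∀ z ∈ Set.Icc x y, a ≤ z ∧ (z : EReal) < b := fun z hz =>
    ⟨hx.1.trans hz.1, lt_of_le_of_lt (EReal.coe_le_coe_iff.2 hz.2) hy.2⟩
  have hT : ∀ z ∈ Set.Icc x y, 0 < 1 - F z := fun z hz =>
    sub_pos.2 (hF.lt_one (hmem z hz).1 (hmem z hz).2)
  have hf : ∀ z ∈ Set.Icc x y, 0 < f z := fun z hz =>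
    (hF.2.2.2.1 z (hmem z hz).1 (hmem z hz).2).2
  have hxx : x ∈ Set.Icc x y := Set.left_mem_Icc.2 hxy
  have hyy : y ∈ Set.Icc x y := Set.right_mem_Icc.2 hxy
  set L : ℝ → ℝ := fun v => (1 - F x) / f x + l * (v - x) with hL
  have hhL : ∀ z ∈ Set.Icc x y, (1 - F z) / f z ≤ L z := by
    intro z hz
    have := hreg hx (hmem z hz) hz.1
    simp only [hL] at this ⊢
    linarith
  have hder : ∀ z ∈ Set.Icc x y, HasDerivAt (fun v => (1 - F v) ^ l * L v)
      ((-f z * l * (1 - F z) ^ (l - 1)) * L z + (1 - F z) ^ l * l) z := by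
    intro z hz
    have h1 := ((hF.2.2.2.1 z (hmem z hz).1 (hmem z hz).2).1.const_sub 1).rpow_const (p := l)
      (Or.inl (hT z hz).ne')
    have h2 : HasDerivAt L l z := by
      have h := (((hasDerivAt_id z).sub_const x).const_mul l).const_add ((1 - F x) / f x)
      rwa [mul_one] at h
    exact h1.mul h2
  have hanti : AntitoneOn (fun v => (1 - F v) ^ l * L v) (Set.Icc x y) := by
    refine antitoneOn_of_deriv_nonpos (convex_Icc x y)
      (fun z hz => (hder z hz).continuousAt.continuousWithinAt)
      (fun z hz => (hder z (interior_subset hz)).differentiableAt.differentiableWithinAt) ?_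
    intro z hz
    have hz := interior_subset hz
    rw [(hder z hz).deriv]
    have h := (div_le_iff₀ (hf z hz)).1 (hhL z hz)
    have e : (1 - F z) ^ l = (1 - F z) ^ (l - 1) * (1 - F z) := by
      rw [Real.rpow_sub_one (hT z hz).ne', div_mul_cancel₀ _ (hT z hz).ne']
    rw [e]
    have hp : 0 ≤ l * (1 - F z) ^ (l - 1) := mul_nonneg hl.le (Real.rpow_nonneg (hT z hz).le _)
    nlinarith [mul_le_mul_of_nonneg_left h hp]
  have hle := hanti hxx hyy hxy
  have hfin : (1 - F y) ^ l * ((1 - F y) / f y) ≤ (1 - F x) ^ l * ((1 - F x) / f x) := by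
    refine (mul_le_mul_of_nonneg_left (hhL y hyy) (Real.rpow_nonneg (hT y hyy).le _)).trans ?_
    simpa [hL] using hle
  have inv_eq : ∀ z ∈ Set.Icc x y,
      f z * (1 - F z) ^ (-l - 1) = ((1 - F z) ^ l * ((1 - F z) / f z))⁻¹ := by
    intro z hz
    rw [Real.rpow_sub_one (hT z hz).ne', Real.rpow_neg (hT z hz).le]
    have := (Real.rpow_pos_of_pos (hT z hz) l).ne'
    have := (hT z hz).ne'
    have := (hf z hz).ne'
    field_simp
  simp only
  rw [inv_eq x hxx, inv_eq y hyy]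
  exact inv_anti₀ (mul_pos (Real.rpow_pos_of_pos (hT y hyy) l)
    (div_pos (hT y hyy) (hf y hyy))) hfin

/-- Convexity of `(1 - F ^ (n + 1)) ^ (-l)`, as a supporting line at an interior point. -/
lemma LambdaRegular.exists_support_line (hl : 0 < l) (hl1 : l ≤ 1) (hF : IsCDF F f a b)
    (hreg : LambdaRegular l F f a b) (n : ℕ) {m : ℝ} (hm : a ≤ m) (hmb : (m : EReal) < b) :
    ∃ C : ℝ, ∀ v : ℝ, a ≤ v → (v : EReal) < b →
      (1 - F m ^ (n + 1)) ^ (-l) + C * (v - m) ≤ (1 - F v ^ (n + 1)) ^ (-l) := by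
  have h0 : ∀ v : ℝ, a ≤ v → 0 ≤ F v := fun v hv => hF.2.2.1 ▸ hF.2.1 hv
  set D : ℝ → ℝ := fun v => l * (n + 1) *
    ((F v ^ n * (∑ i ∈ Finset.range (n + 1), F v ^ i) ^ (-l - 1)) *
      (f v * (1 - F v) ^ (-l - 1))) with hD
  have hmono : MonotoneOn D {x : ℝ | a ≤ x ∧ (x : EReal) < b} := by
    intro x hx y hy hxy
    have h1 := hreg.monotoneOn_density_mul_rpow hl hF hx hy hxy
    have h2 := pow_mul_geom_sum_rpow_monotoneOn hl1 n ⟨h0 x hx.1, (hF.lt_one hx.1 hx.2).le⟩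
      ⟨h0 y hy.1, (hF.lt_one hy.1 hy.2).le⟩ (hF.2.1 hxy)
    have hx1 := sub_pos.2 (hF.lt_one hx.1 hx.2)
    have h3 : 0 ≤ f x * (1 - F x) ^ (-l - 1) :=
      mul_nonneg (hF.2.2.2.1 x hx.1 hx.2).2.le (Real.rpow_nonneg hx1.le _)
    have h4 : 0 ≤ F y ^ n * (∑ i ∈ Finset.range (n + 1), F y ^ i) ^ (-l - 1) :=
      mul_nonneg (pow_nonneg (h0 y hy.1) _)
        (Real.rpow_nonneg (geom_sum_pos_of_nonneg (h0 y hy.1) n).le _)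
    exact mul_le_mul_of_nonneg_left (mul_le_mul h2 h1 h3 h4) (by positivity)
  have hder : ∀ v : ℝ, a ≤ v → (v : EReal) < b →
      HasDerivAt (fun v => (1 - F v ^ (n + 1)) ^ (-l)) (D v) v := by
    intro v hv hvb
    have hlt := hF.lt_one hv hvb
    have hpos : 0 < 1 - F v ^ (n + 1) := sub_pos.2 (pow_lt_one₀ (h0 v hv) hlt (by simp))
    have h := (((hF.2.2.2.1 v hv hvb).1.fun_pow (n + 1)).const_sub 1).rpow_const (p := -l)
      (Or.inl hpos.ne')
    refine h.congr_deriv ?_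
    have e : 1 - F v ^ (n + 1) = (∑ i ∈ Finset.range (n + 1), F v ^ i) * (1 - F v) :=
      (geom_sum_mul_neg (F v) (n + 1)).symm
    simp only [hD]
    rw [e, Real.mul_rpow (geom_sum_pos_of_nonneg (h0 v hv) n).le (sub_pos.2 hlt).le]
    push_cast
    ring
  refine ⟨D m, fun v hv hvb => ?_⟩
  rcases lt_trichotomy v m with hvm | rfl | hvm
  · have hmem : ∀ z ∈ Set.Icc v m, a ≤ z ∧ (z : EReal) < b := fun z hz =>
      ⟨hv.trans hz.1, lt_of_le_of_lt (EReal.coe_le_coe_iff.2 hz.2) hmb⟩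
    obtain ⟨c, hc, hcs⟩ := exists_hasDerivAt_eq_slope (fun v => (1 - F v ^ (n + 1)) ^ (-l)) D hvm
      (fun z hz => (hder z (hmem z hz).1 (hmem z hz).2).continuousAt.continuousWithinAt)
      (fun z hz => hder z (hmem z ⟨hz.1.le, hz.2.le⟩).1 (hmem z ⟨hz.1.le, hz.2.le⟩).2)
    have h := hmono (hmem c ⟨hc.1.le, hc.2.le⟩) ⟨hm, hmb⟩ hc.2.le
    rw [hcs, div_le_iff₀ (by linarith)] at h
    linarith
  · simp
  · have hmem : ∀ z ∈ Set.Icc m v, a ≤ z ∧ (z : EReal) < b := fun z hz =>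
      ⟨hm.trans hz.1, lt_of_le_of_lt (EReal.coe_le_coe_iff.2 hz.2) hvb⟩
    obtain ⟨c, hc, hcs⟩ := exists_hasDerivAt_eq_slope (fun v => (1 - F v ^ (n + 1)) ^ (-l)) D hvm
      (fun z hz => (hder z (hmem z hz).1 (hmem z hz).2).continuousAt.continuousWithinAt)
      (fun z hz => hder z (hmem z ⟨hz.1.le, hz.2.le⟩).1 (hmem z ⟨hz.1.le, hz.2.le⟩).2)
    have h := hmono ⟨hm, hmb⟩ (hmem c ⟨hc.1.le, hc.2.le⟩) hc.1.le
    rw [hcs, le_div_iff₀ (by linarith)] at h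
    linarith

end Regular

lemma orderStat_one_le_iff {s : ℕ} (hs : 0 < s) (v : Fin s → ℝ) (x : ℝ) :
    orderStat s 1 v ≤ x ↔ ∀ i, v i ≤ x := by
  set L := (List.ofFn v).insertionSort (· ≤ ·) with hL
  have hlen : L.length = s := by simp [hL]
  have hlast : s - 1 < L.length := by omega
  have hval : orderStat s 1 v = L[s - 1] := by
    simp only [orderStat, ← hL]
    exact (List.getElem_eq_getD 0).symm
  have hperm : L.Perm (List.ofFn v) := List.perm_insertionSort _ _
  have hsort := List.pairwise_iff_getElem.1 (List.pairwise_insertionSort (· ≤ ·) (List.ofFn v))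
  rw [hval]
  constructor
  · intro h i
    have hi : v i ∈ L := hperm.mem_iff.2 (List.mem_ofFn.2 ⟨i, rfl⟩)
    obtain ⟨k, hk, hki⟩ := List.getElem_of_mem hi
    rw [← hki]
    refine le_trans ?_ h
    rcases (show k ≤ s - 1 by omega).lt_or_eq with hlt | rfl
    · exact hsort k (s - 1) hk hlast hlt
    · exact le_rfl
  · intro h
    obtain ⟨i, hi⟩ := List.mem_ofFn.1 (hperm.mem_iff.1 (List.getElem_mem hlast))
    exact hi ▸ h i

lemma orderStat_one_preimage_Iic {s : ℕ} (hs : 0 < s) (x : ℝ) :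
    orderStat s 1 ⁻¹' Set.Iic x = Set.univ.pi fun _ : Fin s => Set.Iic x := by
  ext v
  simp only [Set.mem_preimage, Set.mem_Iic, Set.mem_univ_pi, orderStat_one_le_iff hs]

lemma measurable_orderStat_one {s : ℕ} (hs : 0 < s) : Measurable (orderStat s 1) :=
  measurable_of_Iic fun x => by
    rw [orderStat_one_preimage_Iic hs]
    exact MeasurableSet.univ_pi fun _ => measurableSet_Iic

lemma map_orderStat_one_Iic {s : ℕ} (hs : 0 < s) (μ : Measure ℝ) [IsProbabilityMeasure μ] (x : ℝ) :
    ((Measure.pi fun _ : Fin s => μ).map (orderStat s 1)) (Set.Iic x) = μ (Set.Iic x) ^ s := by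
  rw [Measure.map_apply (measurable_orderStat_one hs) measurableSet_Iic,
    orderStat_one_preimage_Iic hs, Measure.pi_pi]
  simp

section Law

variable {a : ℝ} {b : EReal} {G : ℝ → ℝ} {ν : Measure ℝ} [IsProbabilityMeasure ν]

lemma ae_mem_of_Iic_eq (hab : (a : EReal) < b) (hGa : G a = 0)
    (hG1 : Tendsto G (Filter.comap (fun x : ℝ => (x : EReal)) (nhdsWithin b (Set.Iio b)))
      (nhds 1))
    (hν : ∀ x : ℝ, a ≤ x → (x : EReal) < b → ν (Set.Iic x) = ENNReal.ofReal (G x)) :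
    ∀ᵐ x ∂ν, a < x ∧ (x : EReal) < b := by
  have h1 : ∀ᵐ x ∂ν, a < x := by
    have h : ν (Set.Iic a) = 0 := by rw [hν a le_rfl hab, hGa, ENNReal.ofReal_zero]
    rw [ae_iff]
    simp only [not_lt]
    exact h
  have h2 : ∀ᵐ x : ℝ ∂ν, (x : EReal) < b := by
    have hmeas : MeasurableSet {x : ℝ | (x : EReal) < b} :=
      measurableSet_lt measurable_coe_real_ereal measurable_const
    have hmeas1 : ν {x : ℝ | (x : EReal) < b} = 1 := by
      refine le_antisymm prob_le_one ?_
      have := comap_nhdsLT_neBot hab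
      have ht := (ENNReal.continuous_ofReal.tendsto 1).comp hG1
      rw [ENNReal.ofReal_one] at ht
      refine le_of_tendsto ht ((eventually_comap_nhdsLT hab).mono fun x hx => ?_)
      rw [Function.comp_apply, ← hν x hx.1 hx.2]
      exact measure_mono fun y hy => lt_of_le_of_lt (EReal.coe_le_coe_iff.2 hy) hx.2
    exact (prob_compl_eq_zero_iff hmeas).2 hmeas1
  filter_upwards [h1, h2] with x hx1 hx2 using ⟨hx1, hx2⟩

/-- The probability integral transform. -/
lemma map_eq_uniform (hab : (a : EReal) < b) (hGm : Monotone G) (hGa : G a = 0)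
    (hGs : StrictMonoOn G {x : ℝ | a ≤ x ∧ (x : EReal) < b})
    (hGc : ∀ x : ℝ, a ≤ x → (x : EReal) < b → ContinuousAt G x)
    (hG1 : Tendsto G (Filter.comap (fun x : ℝ => (x : EReal)) (nhdsWithin b (Set.Iio b)))
      (nhds 1))
    (hν : ∀ x : ℝ, a ≤ x → (x : EReal) < b → ν (Set.Iic x) = ENNReal.ofReal (G x)) :
    ν.map G = volume.restrict (Set.Icc 0 1) := by
  have : IsProbabilityMeasure (ν.map G) :=
    Measure.isProbabilityMeasure_map hGm.measurable.aemeasurable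
  have hae := ae_mem_of_Iic_eq hab hGa hG1 hν
  have := comap_nhdsLT_neBot hab
  refine Measure.ext_of_Iic _ _ fun u => ?_
  rw [Measure.map_apply hGm.measurable measurableSet_Iic,
    Measure.restrict_apply measurableSet_Iic]
  rcases lt_or_ge u 0 with hu | hu
  · have e : Set.Iic u ∩ Set.Icc (0 : ℝ) 1 = ∅ := by
      ext z
      simp only [Set.mem_inter_iff, Set.mem_Iic, Set.mem_Icc, Set.mem_empty_iff_false, iff_false]
      intro h
      linarith [h.1, h.2.1]
    rw [e, measure_empty, ← measure_empty (μ := ν)]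
    refine measure_congr ?_
    filter_upwards [hae] with x hx
    have : G a ≤ G x := hGm hx.1.le
    refine propext ⟨fun h => ?_, fun h => h.elim⟩
    have h : G x ≤ u := h
    linarith
  rcases lt_or_ge u 1 with hu1 | hu1
  · have hev := (hG1.eventually (lt_mem_nhds hu1)).and (eventually_comap_nhdsLT hab)
    obtain ⟨y, hy, hay, hyb⟩ := hev.exists
    have hmem : ∀ z ∈ Set.Icc a y, a ≤ z ∧ (z : EReal) < b := fun z hz =>
      ⟨hz.1, lt_of_le_of_lt (EReal.coe_le_coe_iff.2 hz.2) hyb⟩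
    obtain ⟨x, hx, rfl⟩ := intermediate_value_Icc hay
      (fun z hz => (hGc z (hmem z hz).1 (hmem z hz).2).continuousWithinAt)
      (show u ∈ Set.Icc (G a) (G y) from ⟨hGa ▸ hu, hy.le⟩)
    have e : Set.Iic (G x) ∩ Set.Icc (0 : ℝ) 1 = Set.Icc 0 (G x) := by
      ext z
      simp only [Set.mem_inter_iff, Set.mem_Iic, Set.mem_Icc]
      constructor
      · exact fun h => ⟨h.2.1, h.1⟩
      · exact fun h => ⟨h.2, h.1, h.2.trans hu1.le⟩
    rw [e, Real.volume_Icc, sub_zero, ← hν x (hmem x hx).1 (hmem x hx).2]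
    refine measure_congr ?_
    filter_upwards [hae] with z hz
    exact propext (hGs.le_iff_le ⟨hz.1.le, hz.2⟩ (hmem x hx))
  · have e : Set.Iic u ∩ Set.Icc (0 : ℝ) 1 = Set.Icc 0 1 :=
      Set.inter_eq_right.2 fun z hz => hz.2.trans hu1
    rw [e, Real.volume_Icc, sub_zero, ENNReal.ofReal_one, ← measure_univ (μ := ν)]
    refine measure_congr ?_
    filter_upwards [hae] with z hz
    refine propext ⟨fun _ => trivial, fun _ => le_trans ?_ hu1⟩
    exact ge_of_tendsto hG1 ((eventually_comap_nhdsLT hz.2).mono fun w hw => hGm hw.1)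

end Law

lemma integrable_one_sub_rpow_neg {l : ℝ} (hl : l < 1) :
    Integrable (fun u : ℝ => (1 - u) ^ (-l)) (volume.restrict (Set.Icc 0 1)) := by
  have h := (intervalIntegral.intervalIntegrable_rpow' (a := 1) (b := 0)
    (show -1 < -l by linarith)).comp_sub_left 1
  simp only [sub_self, sub_zero] at h
  rw [intervalIntegrable_iff_integrableOn_Ioc_of_le zero_le_one] at h
  exact (integrableOn_Icc_iff_integrableOn_Ioc).2 h

lemma integral_one_sub_rpow_neg {l : ℝ} (hl : l < 1) :
    ∫ u in Set.Icc (0 : ℝ) 1, (1 - u) ^ (-l) = (1 - l)⁻¹ := by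
  rw [integral_Icc_eq_integral_Ioc, ← intervalIntegral.integral_of_le zero_le_one,
    intervalIntegral.integral_comp_sub_left (fun u : ℝ => u ^ (-l)) 1,
    integral_rpow (Or.inl (by linarith))]
  have h : 1 - l ≠ 0 := by linarith
  simp [Real.zero_rpow h, neg_add_eq_sub]

lemma LambdaRegular.mono {l l' a : ℝ} {b : EReal} {F f : ℝ → ℝ} (h : LambdaRegular l F f a b)
    (hll : l ≤ l') : LambdaRegular l' F f a b := by
  intro x hx y hy hxy
  have := h hx hy hxy
  have := mul_nonneg (sub_nonneg.2 hll) (sub_nonneg.2 hxy)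
  simp only at *
  linarith

lemma rpow_le_one_sub_pow_orderStatExp {l : ℝ} (hl : 0 < l) (hl1 : l < 1)
    {F f : ℝ → ℝ} {a : ℝ} {b : EReal} {μ : Measure ℝ}
    (hF : IsCDF F f a b) (hμ : InducedBy μ F a b) (hreg : LambdaRegular l F f a b) (n : ℕ)
    (hint : Integrable (orderStat (n + 1) 1) (Measure.pi fun _ : Fin (n + 1) => μ)) :
    0 ≤ F (orderStatExp μ 1 (n + 1)) ∧ F (orderStatExp μ 1 (n + 1)) ≤ 1 ∧
      (1 - l) ^ (1 / l) ≤ 1 - F (orderStatExp μ 1 (n + 1)) ^ (n + 1) := by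
  have := hμ.1
  have hmeas := measurable_orderStat_one n.succ_pos
  set P := Measure.pi fun _ : Fin (n + 1) => μ with hP
  set M : (Fin (n + 1) → ℝ) → ℝ := orderStat (n + 1) 1 with hM
  set G : ℝ → ℝ := fun x => max (F x) 0 ^ (n + 1) with hG
  have h0 : ∀ v : ℝ, a ≤ v → 0 ≤ F v := fun v hv => hF.2.2.1 ▸ hF.2.1 hv
  have hGF : ∀ v : ℝ, a ≤ v → G v = F v ^ (n + 1) := fun v hv => by
    simp only [hG, max_eq_left (h0 v hv)]
  have hGm : Monotone G := fun x y hxy =>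
    pow_le_pow_left₀ (le_max_right _ _) (max_le_max_right _ (hF.2.1 hxy)) _
  have hGa : G a = 0 := by simp [hG, hF.2.2.1]
  have hGs : StrictMonoOn G {x : ℝ | a ≤ x ∧ (x : EReal) < b} := by
    intro x hx y hy hxy
    rw [hGF x hx.1, hGF y hy.1]
    exact pow_lt_pow_left₀ (hF.strictMonoOn hx hy hxy) (h0 x hx.1) n.succ_ne_zero
  have hGc : ∀ x : ℝ, a ≤ x → (x : EReal) < b → ContinuousAt G x := fun x hx hxb =>
    ((hF.2.2.2.1 x hx hxb).1.continuousAt.max continuousAt_const).pow _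
  have hG1 : Tendsto G (Filter.comap (fun x : ℝ => (x : EReal)) (nhdsWithin b (Set.Iio b)))
      (nhds 1) := by
    simpa using (hF.2.2.2.2.max (tendsto_const_nhds (x := (0 : ℝ)))).pow (n + 1)
  have hprob : IsProbabilityMeasure (P.map M) :=
    Measure.isProbabilityMeasure_map hmeas.aemeasurable
  have hν : ∀ x : ℝ, a ≤ x → (x : EReal) < b →
      (P.map M) (Set.Iic x) = ENNReal.ofReal (G x) := by
    intro x hx hxb
    rw [map_orderStat_one_Iic n.succ_pos, hμ.2 x hx hxb, hGF x hx,
      ENNReal.ofReal_pow (h0 x hx)]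
  have hae : ∀ᵐ ω ∂P, a < M ω ∧ (M ω : EReal) < b :=
    ae_of_ae_map hmeas.aemeasurable (ae_mem_of_Iic_eq hF.1 hGa hG1 hν)
  have hunif : P.map (fun ω => G (M ω)) = volume.restrict (Set.Icc 0 1) := by
    rw [← map_eq_uniform hF.1 hGm hGa hGs hGc hG1 hν, Measure.map_map hGm.measurable hmeas]
    rfl
  have hGM : Measurable fun ω => G (M ω) := hGm.measurable.comp hmeas
  have hφ : Measurable fun u : ℝ => (1 - u) ^ (-l) :=
    (measurable_const.sub measurable_id).pow_const _
  have hintφ : Integrable (fun ω => (1 - G (M ω)) ^ (-l)) P := by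
    have h := integrable_one_sub_rpow_neg hl1
    rw [← hunif] at h
    exact h.comp_measurable hGM
  have hEφ : ∫ ω, (1 - G (M ω)) ^ (-l) ∂P = (1 - l)⁻¹ := by
    rw [← integral_one_sub_rpow_neg hl1, ← hunif,
      integral_map hGM.aemeasurable hφ.aestronglyMeasurable]
  have hm : orderStatExp μ 1 (n + 1) = ∫ ω, M ω ∂P := rfl
  set m := orderStatExp μ 1 (n + 1)
  have hmb : (m : EReal) < b := by
    obtain ⟨ω, hω, hle⟩ := exists_notMem_null_integral_le hint hae
    simp only [Set.mem_compl_iff, not_not, Set.mem_ofPred_eq] at hω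
    exact lt_of_le_of_lt (EReal.coe_le_coe_iff.2 (hm ▸ hle)) hω.2
  have ham : a ≤ m := by
    obtain ⟨ω, hω, hle⟩ := exists_notMem_null_le_integral hint hae
    simp only [Set.mem_compl_iff, not_not, Set.mem_ofPred_eq] at hω
    exact hω.1.le.trans (hm ▸ hle)
  obtain ⟨C, hC⟩ := hreg.exists_support_line hl hl1.le hF n ham hmb
  have hJ : (1 - F m ^ (n + 1)) ^ (-l) ≤ (1 - l)⁻¹ := by
    rw [← hEφ]
    have hlin : ∫ ω, ((1 - F m ^ (n + 1)) ^ (-l) + C * (M ω - m)) ∂P =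
        (1 - F m ^ (n + 1)) ^ (-l) := by
      have hsub : Integrable (fun ω => C * (M ω - m)) P :=
        (hint.sub (integrable_const m)).const_mul C
      rw [integral_add (integrable_const _) hsub, integral_const_mul,
        integral_sub hint (integrable_const _), ← hm]
      simp
    rw [← hlin]
    refine integral_mono_ae ((integrable_const _).add
      ((hint.sub (integrable_const _)).const_mul _)) hintφ ?_
    filter_upwards [hae] with ω hω
    rw [hGF _ hω.1.le]
    exact hC _ hω.1.le hω.2
  have hlt := hF.lt_one ham hmb
  have hpos : 0 < 1 - F m ^ (n + 1) :=
    sub_pos.2 (pow_lt_one₀ (h0 m ham) hlt n.succ_ne_zero)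
  refine ⟨h0 m ham, hlt.le, ?_⟩
  rw [Real.rpow_neg hpos.le] at hJ
  have h1 : 1 - l ≤ (1 - F m ^ (n + 1)) ^ l :=
    (inv_le_inv₀ (Real.rpow_pos_of_pos hpos l) (by linarith)).1 hJ
  calc (1 - l) ^ (1 / l) ≤ ((1 - F m ^ (n + 1)) ^ l) ^ (1 / l) :=
        Real.rpow_le_rpow (by linarith) h1 (by positivity)
    _ = 1 - F m ^ (n + 1) := by
        rw [← Real.rpow_mul hpos.le, mul_one_div_cancel hl.ne', Real.rpow_one]

theorem stmt4 (lam : ℝ) (hlam : lam ∈ Set.Ico (0:ℝ) 1)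
    (F f : ℝ → ℝ) (a : ℝ) (b : EReal) (ha : 0 ≤ a)
    (μ : Measure ℝ)
    (hF : IsCDF F f a b) (hμ : InducedBy μ F a b)
    (hreg : LambdaRegular lam F f a b)
    (s : ℕ) (hs : 2 ≤ s)
    (hint : Integrable (orderStat s 1) (Measure.pi fun _ : Fin s => μ))
    (m : ℝ) (hm : m = orderStatExp μ 1 s) :
    1 - (F m) ^ (s - 1) ≥ (((s : ℝ) - 1) / s) * cReg lam := by
  obtain ⟨n, rfl⟩ : ∃ n, s = n + 1 := ⟨s - 1, by omega⟩
  have key : 0 ≤ F m ∧ F m ≤ 1 ∧ cReg lam ≤ 1 - F m ^ (n + 1) := by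
    rcases hlam.1.eq_or_lt with rfl | hpos
    · have hbd : ∀ k : ℕ, 2 ≤ k → 0 ≤ F m ∧ F m ≤ 1 ∧
          (1 + -1 / (k : ℝ)) ^ k ≤ 1 - F m ^ (n + 1) := by
        intro k hk
        have hk' : (2 : ℝ) ≤ k := by exact_mod_cast hk
        have hk0 : (0 : ℝ) < 1 / k := by positivity
        have hk1 : (1 : ℝ) / k < 1 := by rw [div_lt_one (by linarith)]; linarith
        have h := rpow_le_one_sub_pow_orderStatExp hk0 hk1 hF hμ (hreg.mono hk0.le) n hint
        rw [← hm, one_div_one_div, Real.rpow_natCast] at h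
        rwa [neg_div, ← sub_eq_add_neg]
      refine ⟨(hbd 2 le_rfl).1, (hbd 2 le_rfl).2.1, ?_⟩
      rw [cReg, if_pos rfl, ← Real.exp_neg]
      exact le_of_tendsto (Real.tendsto_one_add_div_pow_exp (-1))
        ((eventually_ge_atTop 2).mono fun k hk => (hbd k hk).2.2)
    · rw [cReg, if_neg hpos.ne', hm]
      exact rpow_le_one_sub_pow_orderStatExp hpos hlam.2 hF hμ hreg n hint
  obtain ⟨h0, h1, hc⟩ := key
  have hpow := succ_mul_pow_le h0 h1 n
  have hn : (0 : ℝ) < n + 1 := by positivity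
  push_cast
  rw [add_sub_cancel_right, ge_iff_le, div_mul_eq_mul_div,
    div_le_iff₀ hn]
  have := mul_le_mul_of_nonneg_left hc (Nat.cast_nonneg (α := ℝ) n)
  linarith
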